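/- For every nonzero t₅ ∈ ℂ, the 6×6 matrix M₅(t₅), viewed over the field of rational functions ℂ(q), with rows (0, 0, 0, 0, 4q, 0), (4, t₅q, 0, 0, 0, 4q), (0, 4, 0, t₅q, 0, 0), (0, 4, t₅q, 0, 0, 0), (0, 0, 4, 4, t₅q, 0), (−3t₅, 0, 0, 0, 4, 0), has squarefree characteristic polynomial; equivalently, the resultant of its characteristic polynomial with its derivative is nonzero, i.e. M₅(t₅) has simple spectrum. -/

import Mathlib

/-- The resultant of two polynomials `p` and `q`, computed as the determinant of
the Sylvester matrix built with respect to the degree bounds `m` for `p` and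
`n` for `q`. -/
noncomputable def sylvesterRes {R : Type*} [CommRing R] (m n : ℕ)
    (p q : Polynomial R) : R :=
  (Matrix.of (fun i j : Fin (m + n) =>
    if (i : ℕ) < n then
      (if (j : ℕ) ≤ m + (i : ℕ) then p.coeff (m + (i : ℕ) - (j : ℕ)) else 0)
    else
      (if (j : ℕ) ≤ ((i : ℕ) - n) + n then
        q.coeff (((i : ℕ) - n) + n - (j : ℕ)) else 0))).det

open RatFunc in
/-- The energy-2 truncation of the Dubrovin operator of `Gr(2,4)` with bulk
parameter supported on the Schubert class `σ₍₂,₂₎`, viewed over `ℂ(q)`. -/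
noncomputable def M5R (t : ℂ) : Matrix (Fin 6) (Fin 6) (RatFunc ℂ) :=
  !![0,            0,       0,       0,       4 * X,   0;
     4,            C t * X, 0,       0,       0,       4 * X;
     0,            4,       0,       C t * X, 0,       0;
     0,            4,       C t * X, 0,       0,       0;
     0,            0,       4,       4,       C t * X, 0;
     C (-3 * t),   0,       0,       0,       4,       0]

open Polynomial in
theorem sylvesterRes_eq_resultant {R : Type*} [CommRing R] {m n : ℕ} {p q : R[X]}
    (hp : p.natDegree ≤ m) (hq : q.natDegree ≤ n) :
    sylvesterRes m n p q = resultant p q m n := by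
  rw [sylvesterRes, resultant, ← Matrix.det_transpose (sylvester p q m n),
    ← Matrix.det_submatrix_equiv_self Fin.revPerm (sylvester p q m n).transpose]
  congr 1
  ext i j
  have hi := i.isLt
  have hj := j.isLt
  simp only [Matrix.of_apply, Matrix.submatrix_apply, Matrix.transpose_apply, Fin.revPerm_apply,
    sylvester]
  split_ifs with h1 h2 h2
  · have e : Fin.rev i = Fin.natAdd m ⟨n - 1 - i, by omega⟩ := by
      ext; simp only [Fin.val_rev, Fin.val_natAdd]; omega
    rw [e, Fin.addCases_right]
    simp only [Fin.val_rev, Set.mem_Icc]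
    split_ifs with h3
    · congr 1; omega
    · exact coeff_eq_zero_of_natDegree_lt (by omega)
  · have e : Fin.rev i = Fin.natAdd m ⟨n - 1 - i, by omega⟩ := by
      ext; simp only [Fin.val_rev, Fin.val_natAdd]; omega
    rw [e, Fin.addCases_right, if_neg]
    simp only [Fin.val_rev, Set.mem_Icc]
    omega
  · have e : Fin.rev i = Fin.castAdd n ⟨m + n - 1 - i, by omega⟩ := by
      ext; simp only [Fin.val_rev, Fin.val_castAdd]; omega
    rw [e, Fin.addCases_left]
    simp only [Fin.val_rev, Set.mem_Icc]
    split_ifs with h3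
    · congr 1; omega
    · exact coeff_eq_zero_of_natDegree_lt (by omega)
  · have e : Fin.rev i = Fin.castAdd n ⟨m + n - 1 - i, by omega⟩ := by
      ext; simp only [Fin.val_rev, Fin.val_castAdd]; omega
    rw [e, Fin.addCases_left, if_neg]
    simp only [Fin.val_rev, Set.mem_Icc]
    omega

theorem sylvesterRes_derivative_ne_zero {K : Type*} [Field K] [CharZero K]
    {p : Polynomial K} {n : ℕ} (hp : p.natDegree = n + 1) (h : p.Separable) :
    sylvesterRes (n + 1) n p p.derivative ≠ 0 := by
  have hd : p.derivative.natDegree = n := by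
    rw [Polynomial.natDegree_derivative, hp, Nat.add_sub_cancel]
  rw [sylvesterRes_eq_resultant hp.le hd.le]
  simpa only [hp, hd] using Polynomial.resultant_ne_zero p p.derivative h

theorem det_gr24_pencil {R : Type*} [CommRing R] (x y q w : R) (hw : w * q = -3 * y) :
    (!![x, 0, 0, 0, -(4 * q), 0;
        -4, x - y, 0, 0, 0, -(4 * q);
        0, -4, x, -y, 0, 0;
        0, -4, -y, x, 0, 0;
        0, 0, -4, -4, x - y, 0;
        -w, 0, 0, 0, -4, x] : Matrix (Fin 6) (Fin 6) R).det =
      (x + y) * (x ^ 2 * (x - y) ^ 3 - 512 * q * (2 * x - 3 * y)) := by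
  simp [Matrix.det_succ_row_zero, Fin.sum_univ_succ, Fin.succAbove]
  linear_combination (-512 * q * (x + y)) * hw

open Polynomial in
theorem charpoly_M5R (t : ℂ) :
    (M5R t).charpoly =
      (X + C (RatFunc.C t * RatFunc.X)) *
        (X ^ 2 * (X - C (RatFunc.C t * RatFunc.X)) ^ 3 -
          512 * C RatFunc.X * (2 * X - 3 * C (RatFunc.C t * RatFunc.X))) := by
  rw [← det_gr24_pencil X (C (RatFunc.C t * RatFunc.X)) (C RatFunc.X) (C (RatFunc.C (-3 * t)))
    (by rw [← C_mul]; simp only [map_mul, map_neg, map_ofNat]; ring), Matrix.charpoly]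
  congr 1
  ext1 i j
  fin_cases i <;> fin_cases j <;> simp [M5R, C_ofNat]

/-- A common root of `x ^ 2 * (x - y) ^ 3 - 512 * q * (2 * x - 3 * y)` and its derivative in `x`
forces an algebraic relation between `y` and `q`. -/
theorem quintic_discriminant_eq_zero {L : Type*} [Field L] [CharZero L] {x y q : L} (hq : q ≠ 0)
    (h : x ^ 2 * (x - y) ^ 3 - 512 * q * (2 * x - 3 * y) = 0)
    (h' : x * (x - y) ^ 2 * (5 * x - 2 * y) - 1024 * q = 0) :
    4096 * (1024 * q) ^ 2 - 20325 * (1024 * q) * y ^ 4 + 648 * y ^ 8 = 0 := by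
  have hx : x * (x - y) ^ 2 ≠ 0 := fun h0 => hq (by
    linear_combination ((5 * x - 2 * y) * h0 - h') / 1024)
  have hQ : 8 * x ^ 2 - 17 * x * y + 6 * y ^ 2 = 0 := by
    refine (mul_eq_zero.mp ?_).resolve_left hx
    linear_combination (-2) * h + (2 * x - 3 * y) * h'
  have hN : 1024 * q - (-447 / 256) * y ^ 4 - 2037 / 512 * x * y ^ 3 = 0 := by
    linear_combination
      (5 / 8 * x ^ 2 - 11 / 64 * x * y + 149 / 512 * y ^ 2) * hQ - h'
  linear_combination 512 * ((2037 / 512) ^ 2 * y ^ 6 * hQ +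
    (8 * (1024 * q + 447 / 256 * y ^ 4 + 2037 / 512 * x * y ^ 3) - 17 * (2037 / 512) * y ^ 4) * hN)

open Polynomial in
theorem separable_of_discriminant_ne_zero {K : Type*} [Field K] [CharZero K] {y q : K}
    (hy : y ≠ 0) (hq : q ≠ 0) (h₁ : y ^ 4 - 320 * q ≠ 0)
    (h₂ : 4096 * (1024 * q) ^ 2 - 20325 * (1024 * q) * y ^ 4 + 648 * y ^ 8 ≠ 0) :
    ((X + C y) * (X ^ 2 * (X - C y) ^ 3 - 512 * C q * (2 * X - 3 * C y))).Separable := by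
  have : CharZero (AlgebraicClosure K) := charZero_of_injective_algebraMap
    (algebraMap K (AlgebraicClosure K)).injective
  refine (isCoprime_iff_aeval_ne_zero_of_isAlgClosed K (AlgebraicClosure K) _ _).mpr fun x => ?_
  by_contra! hcon
  obtain ⟨h, h'⟩ := hcon
  simp only [derivative_mul, derivative_pow, derivative_X,
    derivative_C, derivative_ofNat, map_mul, map_add, map_sub, map_pow, aeval_X, aeval_C, map_ofNat,
    map_zero, map_one, map_natCast] at h h'
  push_cast at h'
  replace hy := (map_ne_zero (algebraMap K (AlgebraicClosure K))).mpr hy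
  replace hq := (map_ne_zero (algebraMap K (AlgebraicClosure K))).mpr hq
  replace h₁ := (map_ne_zero (algebraMap K (AlgebraicClosure K))).mpr h₁
  replace h₂ := (map_ne_zero (algebraMap K (AlgebraicClosure K))).mpr h₂
  simp only [map_mul, map_add, map_sub, map_pow, map_ofNat] at h₁ h₂
  generalize algebraMap K (AlgebraicClosure K) y = y at *
  generalize algebraMap K (AlgebraicClosure K) q = q at *
  have hne : x + y ≠ 0 := fun hx => by
    obtain rfl : x = -y := by linear_combination hx
    refine mul_ne_zero hy h₁ ?_
    linear_combination (-1 / 8) * h'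
  have hg := (mul_eq_zero.mp h).resolve_left hne
  refine h₂ (quintic_discriminant_eq_zero hq hg ((mul_eq_zero.mp ?_).resolve_left hne))
  linear_combination h' - hg

open Polynomial in
theorem separable_charpoly_M5R (t : ℂ) (ht : t ≠ 0) : (M5R t).charpoly.Separable := by
  rw [charpoly_M5R]
  have hX := RatFunc.X_ne_zero (K := ℂ)
  have algebraMap_ne {f : ℂ[X]} (hf : f.eval 0 ≠ 0) : algebraMap ℂ[X] (RatFunc ℂ) f ≠ 0 :=
    RatFunc.algebraMap_ne_zero fun h => hf (by simp [h])
  have h₁ := algebraMap_ne (f := C t ^ 4 * X ^ 3 - 320) (by simp)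
  have h₂ := algebraMap_ne
    (f := 4096 * 1024 ^ 2 - 20325 * 1024 * (C t ^ 4 * X ^ 3) + 648 * (C t ^ 8 * X ^ 6)) (by simp)
  simp only [map_mul, map_add, map_sub, map_pow, map_ofNat, RatFunc.algebraMap_C,
    RatFunc.algebraMap_X] at h₁ h₂
  refine separable_of_discriminant_ne_zero (mul_ne_zero (by simpa using ht) hX) hX ?_ ?_
  · convert mul_ne_zero hX h₁ using 1
    ring
  · convert mul_ne_zero (pow_ne_zero 2 hX) h₂ using 1
    ring

/-- For every `t ≠ 0`, the matrix `M5R t` has squarefree characteristic polynomial;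
equivalently the resultant of its characteristic polynomial with its derivative is
nonzero, i.e. it has simple spectrum. -/
theorem simple_spectrum_M5R (t : ℂ) (ht : t ≠ 0) :
    Squarefree (M5R t).charpoly ∧
      sylvesterRes 6 5 (M5R t).charpoly (M5R t).charpoly.derivative ≠ 0 := by
  have hsep := separable_charpoly_M5R t ht
  refine ⟨hsep.squarefree, sylvesterRes_derivative_ne_zero ?_ hsep⟩
  rw [Matrix.charpoly_natDegree_eq_dim, Fintype.card_fin]
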